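/- With K ≡ −1 on the closed disk and h(x₁,x₂) = 3 + x₁ on ∂𝔻, the prescribed curvature problem for (K,h) has no solution: there is no u ∈ C²(closed 𝔻) with −Δu = −2e^{u} in 𝔻 and ∂_ν u + 2 = 2(3+x₁)e^{u/2} on ∂𝔻. -/

import Mathlib

open MeasureTheory Real Filter

noncomputable section

/-- The open unit disk in ℝ² ≅ ℂ. -/
def unitDisk : Set ℂ := Metric.ball 0 1

/-- The unit circle ∂𝔻. -/
def unitCircle : Set ℂ := Metric.sphere 0 1

/-- The closed unit disk. -/
def closedUnitDisk : Set ℂ := Metric.closedBall 0 1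

/-- Directional derivative of `u` at `x` in direction `v`. -/
def pd (u : ℂ → ℝ) (v x : ℂ) : ℝ := fderiv ℝ u x v

/-- Laplacian of `u` at `x`. -/
def lap (u : ℂ → ℝ) (x : ℂ) : ℝ :=
  fderiv ℝ (fun y => pd u 1 y) x 1 + fderiv ℝ (fun y => pd u Complex.I y) x Complex.I

/-- Squared norm of the gradient, |∇u|². -/
def gradSq (u : ℂ → ℝ) (x : ℂ) : ℝ := pd u 1 x ^ 2 + pd u Complex.I x ^ 2

/-- Outward normal derivative ∂_ν u(x) = ∇u(x)·x at a boundary point. -/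
def nderiv (u : ℂ → ℝ) (x : ℂ) : ℝ := x.re * pd u 1 x + x.im * pd u Complex.I x

/-- Tangential derivative ∂_τ u(x) = ∇u(x)·(−x₂,x₁) at a boundary point. -/
def tderiv (u : ℂ → ℝ) (x : ℂ) : ℝ := -x.im * pd u 1 x + x.re * pd u Complex.I x

/-- Unit-speed parametrization of the unit circle. -/
def bpt (θ : ℝ) : ℂ := Complex.exp ((θ : ℂ) * Complex.I)

/-- Integral over ∂𝔻 with respect to arclength. -/
def bint (f : ℂ → ℝ) : ℝ := ∫ θ in (0:ℝ)..(2 * π), f (bpt θ)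

/-- A solution of the prescribed curvature problem for `(K, h)`. -/
def IsSolution (K h u : ℂ → ℝ) : Prop :=
  ContDiff ℝ 2 u ∧
  (∀ x ∈ unitDisk, -lap u x = 2 * K x * Real.exp (u x)) ∧
  (∀ x ∈ unitCircle, nderiv u x + 2 = 2 * h x * Real.exp (u x / 2))

/-- The auxiliary function Φ = H + √(H² + K). -/
def Phi (K H : ℂ → ℝ) (x : ℂ) : ℝ := H x + Real.sqrt (H x ^ 2 + K x)

/-- `H` is the harmonic extension of `h`, C¹ up to the boundary. -/
def IsHarmExt (h H : ℂ → ℝ) : Prop :=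
  ContDiff ℝ 1 H ∧ ContDiffOn ℝ 2 H unitDisk ∧
  (∀ x ∈ unitDisk, lap H x = 0) ∧ ∀ x ∈ unitCircle, H x = h x

/-- K_ε. -/
def Keps (K : ℂ → ℝ) (ε : ℝ) (x : ℂ) : ℝ := (K x - ε / 2) / (1 + ε)

/-- h_ε. -/
def heps (h : ℂ → ℝ) (ε : ℝ) (x : ℂ) : ℝ := h x / (1 + ε)

/-- K̃_ε. -/
def Ktil (ε : ℝ) : ℝ := -ε / (2 * (1 + ε))

/-- h̃_ε. -/
def htil (ε : ℝ) : ℝ := 1 / (1 + ε)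

/-- A solution of the perturbed problem (P_ε). -/
def IsPerturbedSolution (K h : ℂ → ℝ) (ε : ℝ) (u : ℂ → ℝ) : Prop :=
  ContDiff ℝ 2 u ∧
  (∀ x ∈ unitDisk, -lap u x + 2 * Ktil ε = 2 * Keps K ε x * Real.exp (u x)) ∧
  (∀ x ∈ unitCircle, nderiv u x + 2 * htil ε = 2 * heps h ε x * Real.exp (u x / 2))

/-- The energy functional I. -/
def Ifun (K h u : ℂ → ℝ) : ℝ :=
  (∫ x in unitDisk, ((1/2) * gradSq u x - 2 * K x * Real.exp (u x))) +
  bint (fun x => 2 * u x - 4 * h x * Real.exp (u x / 2))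

/-- The perturbation term T. -/
def Tfun (u : ℂ → ℝ) : ℝ :=
  ∫ x in unitDisk, ((1/2) * gradSq u x + Real.exp (u x) - u x)

/-- The perturbed functional I_ε. -/
def Ieps (K h : ℂ → ℝ) (ε : ℝ) (u : ℂ → ℝ) : ℝ := (Ifun K h u + ε * Tfun u) / (1 + ε)

lemma clm_re_im (L : ℂ →L[ℝ] ℝ) (z : ℂ) : L z = z.re * L 1 + z.im * L Complex.I := by
  conv_lhs => rw [← Complex.re_add_im z]
  have h1 : ((z.re : ℂ)) = z.re • (1 : ℂ) := by simp
  have h2 : ((z.im : ℂ)) * Complex.I = z.im • Complex.I := by simp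
  rw [h1, h2, map_add, map_smul, map_smul]; simp

/-- polar coordinates -/
def pol (x : ℝ × ℝ) : ℂ := (x.1 : ℂ) * ((Real.cos x.2 : ℂ) + (Real.sin x.2 : ℂ) * Complex.I)

lemma pol_re (x : ℝ × ℝ) : (pol x).re = x.1 * Real.cos x.2 := by
  simp only [pol, Complex.mul_re, Complex.add_re, Complex.add_im, Complex.ofReal_re,
    Complex.ofReal_im, Complex.I_re, Complex.I_im, Complex.mul_im]; ring

lemma pol_im (x : ℝ × ℝ) : (pol x).im = x.1 * Real.sin x.2 := by
  simp only [pol, Complex.mul_re, Complex.add_re, Complex.add_im, Complex.ofReal_re,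
    Complex.ofReal_im, Complex.I_re, Complex.I_im, Complex.mul_im]; ring

lemma pol_norm (x : ℝ × ℝ) : ‖pol x‖ = |x.1| := by
  rw [← sq_eq_sq₀ (norm_nonneg _) (abs_nonneg _), sq_abs, ← Complex.normSq_eq_norm_sq,
    Complex.normSq_apply, pol_re, pol_im]
  linear_combination x.1 ^ 2 * Real.sin_sq_add_cos_sq x.2

lemma pol_diff : Differentiable ℝ pol := by
  have h1 : Differentiable ℝ (fun x : ℝ × ℝ => (x.1 : ℂ)) :=
    Complex.ofRealCLM.differentiable.comp differentiable_fst
  have h2 : Differentiable ℝ (fun x : ℝ × ℝ => ((Real.cos x.2 : ℝ) : ℂ)) :=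
    Complex.ofRealCLM.differentiable.comp (Real.differentiable_cos.comp differentiable_snd)
  have h3 : Differentiable ℝ (fun x : ℝ × ℝ => ((Real.sin x.2 : ℝ) : ℂ)) :=
    Complex.ofRealCLM.differentiable.comp (Real.differentiable_sin.comp differentiable_snd)
  exact h1.mul (h2.add (h3.mul_const _))

lemma pol_dr (r θ : ℝ) : HasDerivAt (fun t : ℝ => pol (t, θ))
    ((Real.cos θ : ℂ) + (Real.sin θ : ℂ) * Complex.I) r := by
  have := ((hasDerivAt_id r).ofReal_comp).mul_const ((Real.cos θ : ℂ) + (Real.sin θ : ℂ) * Complex.I)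
  simpa [pol] using this

lemma pol_dt (r θ : ℝ) : HasDerivAt (fun t : ℝ => pol (r, t))
    ((r : ℂ) * ((-Real.sin θ : ℝ) + (Real.cos θ : ℂ) * Complex.I)) θ :=
  (((Real.hasDerivAt_cos θ).ofReal_comp).add
    (((Real.hasDerivAt_sin θ).ofReal_comp).mul_const Complex.I)).const_mul (r : ℂ)

lemma comp_dr {V : ℂ → ℝ} (hV : Differentiable ℝ V) (r θ : ℝ) :
    HasDerivAt (fun t : ℝ => V (pol (t, θ)))
      (Real.cos θ * pd V 1 (pol (r, θ)) + Real.sin θ * pd V Complex.I (pol (r, θ))) r := by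
  have := (hV (pol (r, θ))).hasFDerivAt.comp_hasDerivAt r (pol_dr r θ)
  rw [clm_re_im] at this
  refine this.congr_deriv ?_
  simp only [Complex.mul_re, Complex.add_re, Complex.add_im, Complex.ofReal_re,
    Complex.ofReal_im, Complex.I_re, Complex.I_im, Complex.mul_im, pd]
  ring

lemma comp_dt {V : ℂ → ℝ} (hV : Differentiable ℝ V) (r θ : ℝ) :
    HasDerivAt (fun t : ℝ => V (pol (r, t)))
      (r * (-Real.sin θ * pd V 1 (pol (r, θ)) + Real.cos θ * pd V Complex.I (pol (r, θ)))) θ := by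
  have := (hV (pol (r, θ))).hasFDerivAt.comp_hasDerivAt θ (pol_dt r θ)
  rw [clm_re_im] at this
  refine this.congr_deriv ?_
  simp only [Complex.mul_re, Complex.add_re, Complex.add_im, Complex.ofReal_re,
    Complex.ofReal_im, Complex.I_re, Complex.I_im, Complex.mul_im, pd]
  ring

lemma flux_zero {V W : ℂ → ℝ} (hV : Differentiable ℝ V) (hW : Differentiable ℝ W)
    (hdiv : ∀ z ∈ unitDisk, pd V 1 z + pd W Complex.I z = 0) :
    ∫ θ in (0:ℝ)..(2 * π), (Real.cos θ * V (pol (1, θ)) + Real.sin θ * W (pol (1, θ))) = 0 := by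
  set f : ℝ × ℝ → ℝ := fun x => x.1 * (Real.cos x.2 * V (pol x) + Real.sin x.2 * W (pol x)) with hf
  set g : ℝ × ℝ → ℝ := fun x => -Real.sin x.2 * V (pol x) + Real.cos x.2 * W (pol x) with hg
  have hc : Differentiable ℝ (fun x : ℝ × ℝ => Real.cos x.2) :=
    Real.differentiable_cos.comp differentiable_snd
  have hs : Differentiable ℝ (fun x : ℝ × ℝ => Real.sin x.2) :=
    Real.differentiable_sin.comp differentiable_snd
  have hVp : Differentiable ℝ (fun x => V (pol x)) := hV.comp pol_diff
  have hWp : Differentiable ℝ (fun x => W (pol x)) := hW.comp pol_diff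
  have hfd : Differentiable ℝ f := differentiable_fst.mul ((hc.mul hVp).add (hs.mul hWp))
  have hgd : Differentiable ℝ g := (hs.neg.mul hVp).add (hc.mul hWp)
  have hzero : ∀ x ∈ Set.Ioo (min (0:ℝ) 1) (max 0 1) ×ˢ Set.Ioo (min (0:ℝ) (2*π)) (max 0 (2*π)),
      fderiv ℝ f x (1, 0) + fderiv ℝ g x (0, 1) = 0 := by
    rintro ⟨r, θ⟩ ⟨⟨h0, h1⟩, -⟩
    have h0 : 0 < r := by simpa using h0
    have h1 : r < 1 := by simpa using h1
    have hin : pol (r, θ) ∈ unitDisk := by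
      simp [unitDisk, pol_norm, abs_of_pos h0, h1]
    have e1 : HasDerivAt (fun t : ℝ => f (t, θ)) (fderiv ℝ f (r, θ) (1, 0)) r :=
      HasFDerivAt.comp_hasDerivAt (f := fun t : ℝ => (t, θ)) r (hfd (r, θ)).hasFDerivAt
        ((hasDerivAt_id r).prodMk (hasDerivAt_const r θ))
    have e2 : HasDerivAt (fun t : ℝ => g (r, t)) (fderiv ℝ g (r, θ) (0, 1)) θ :=
      (hgd (r, θ)).hasFDerivAt.comp_hasDerivAt θ
        ((hasDerivAt_const θ r).prodMk (hasDerivAt_id θ))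
    have e1' := (hasDerivAt_id r).mul
      (((comp_dr hV r θ).const_mul (Real.cos θ)).add ((comp_dr hW r θ).const_mul (Real.sin θ)))
    have e2' := ((Real.hasDerivAt_sin θ).neg.mul (comp_dt hV r θ)).add
      ((Real.hasDerivAt_cos θ).mul (comp_dt hW r θ))
    rw [e1.unique e1', e2.unique e2']
    simp only [id, Pi.add_apply, Pi.neg_apply]
    linear_combination r * hdiv _ hin + r * (pd V 1 (pol (r, θ)) + pd W Complex.I (pol (r, θ))) *
      Real.sin_sq_add_cos_sq θ
  classical
  set S := Set.Ioo (min (0:ℝ) 1) (max 0 1) ×ˢ Set.Ioo (min (0:ℝ) (2*π)) (max 0 (2*π)) with hS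
  have key := integral2_divergence_prod_of_hasFDerivAt_off_countable f g
    (fun x => if x ∈ S then fderiv ℝ f x else 0) (fun x => if x ∈ S then fderiv ℝ g x else 0)
    0 0 1 (2 * π) ∅ Set.countable_empty hfd.continuous.continuousOn hgd.continuous.continuousOn
    (by
      intro x hx
      have hx' : x ∈ S := hx.1
      simpa [hx'] using (hfd x).hasFDerivAt)
    (by
      intro x hx
      have hx' : x ∈ S := hx.1
      simpa [hx'] using (hgd x).hasFDerivAt)
  have hz : ∀ x : ℝ × ℝ, (if x ∈ S then fderiv ℝ f x else 0) (1, 0)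
      + (if x ∈ S then fderiv ℝ g x else 0) (0, 1) = 0 := by
    intro x
    by_cases h : x ∈ S
    · simpa [h] using hzero x h
    · simp [h]
  simp only [hz] at key
  have key := key integrableOn_zero
  simpa [hf, hg, pol] using key.symm

/-- Nonexistence for K ≡ −1 and h(x₁,x₂) = 3 + x₁. -/
theorem nonexistence_example :
    ¬ ∃ u : ℂ → ℝ, ContDiff ℝ 2 u ∧
      (∀ x ∈ unitDisk, -lap u x = -2 * Real.exp (u x)) ∧
      (∀ x ∈ unitCircle, nderiv u x + 2 = 2 * (3 + x.re) * Real.exp (u x / 2)) := by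
  rintro ⟨u, hu, hpde, hbc⟩
  have hud : Differentiable ℝ u := hu.differentiable (by norm_num)
  have hfd : ContDiff ℝ 1 (fderiv ℝ u) := hu.fderiv_right (by norm_num)
  have hfdd : Differentiable ℝ (fderiv ℝ u) := hfd.differentiable (by norm_num)
  have hpd : ∀ v, Differentiable ℝ (fun z => pd u v z) := fun v =>
    hfdd.clm_apply (differentiable_const v)
  have hpdd : ∀ v w z, fderiv ℝ (fun z => pd u v z) z w = fderiv ℝ (fderiv ℝ u) z w v := by
    intro v w z
    have := ((hfdd z).hasFDerivAt.clm_apply (hasFDerivAt_const v z)).fderiv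
    have e : (fun z => pd u v z) = fun y => (fderiv ℝ u y) v := rfl
    rw [e, this]; simp
  have hsymm : ∀ z, fderiv ℝ (fun z => pd u Complex.I z) z 1
      = fderiv ℝ (fun z => pd u 1 z) z Complex.I := by
    intro z
    rw [hpdd, hpdd]
    exact (hu.contDiffAt.isSymmSndFDerivAt (by simp)) 1 Complex.I
  set p : ℂ → ℝ := fun z => pd u 1 z with hp
  set q : ℂ → ℝ := fun z => pd u Complex.I z with hq
  have hpD : Differentiable ℝ p := hpd 1
  have hqD : Differentiable ℝ q := hpd Complex.I
  set V : ℂ → ℝ := fun z => (p z ^ 2 - q z ^ 2) / 2 * ((z.re ^ 2 - z.im ^ 2 - 1) / 2)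
    + p z * q z * (z.re * z.im) - 2 * Real.exp (u z) * ((z.re ^ 2 - z.im ^ 2 - 1) / 2)
    + 2 * z.re * p z - 2 * u z with hVdef
  set W : ℂ → ℝ := fun z => p z * q z * ((z.re ^ 2 - z.im ^ 2 - 1) / 2)
    + (q z ^ 2 - p z ^ 2) / 2 * (z.re * z.im) - 2 * Real.exp (u z) * (z.re * z.im)
    + 2 * z.re * q z with hWdef
  have hre : Differentiable ℝ (fun z : ℂ => z.re) := Complex.reCLM.differentiable
  have him : Differentiable ℝ (fun z : ℂ => z.im) := Complex.imCLM.differentiable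
  have hV : Differentiable ℝ V := by fun_prop
  have hW : Differentiable ℝ W := by fun_prop
  -- line derivatives
  have line : ∀ (F : ℂ → ℝ), Differentiable ℝ F → ∀ z v : ℂ,
      HasDerivAt (fun t : ℝ => F (z + t • v)) (fderiv ℝ F z v) 0 := by
    intro F hF z v
    have h1 : HasDerivAt (fun t : ℝ => z + t • v) v 0 := by
      simpa using ((hasDerivAt_id (0:ℝ)).smul_const v).const_add z
    have h2 : HasFDerivAt F (fderiv ℝ F z) (z + (0:ℝ) • v) := by
      simpa using (hF z).hasFDerivAt
    exact h2.comp_hasDerivAt (0:ℝ) h1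
  have dre : ∀ z v : ℂ, fderiv ℝ (fun z : ℂ => z.re) z v = v.re := fun z v => by
    have : fderiv ℝ (fun z : ℂ => z.re) z = Complex.reCLM := Complex.reCLM.fderiv
    rw [this]; rfl
  have dim : ∀ z v : ℂ, fderiv ℝ (fun z : ℂ => z.im) z v = v.im := fun z v => by
    have : fderiv ℝ (fun z : ℂ => z.im) z = Complex.imCLM := Complex.imCLM.fderiv
    rw [this]; rfl
  have hdiv : ∀ z ∈ unitDisk, pd V 1 z + pd W Complex.I z = 0 := by
    intro z hz
    have A : ∀ v : ℂ, HasDerivAt (fun t : ℝ => z.re) 0 0 := fun _ => hasDerivAt_const _ _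
    have hX1 := fun v => ((((line _ hre z v).pow 2).sub ((line _ him z v).pow 2)).sub_const 1).div_const 2
    have hX2 := fun v => (line _ hre z v).mul (line _ him z v)
    have hE := fun v => ((line _ hud z v).exp).const_mul 2
    have hVd := ((((((((line _ hpD z 1).pow 2).sub ((line _ hqD z 1).pow 2)).div_const 2).mul (hX1 1)).add
      (((line _ hpD z 1).mul (line _ hqD z 1)).mul (hX2 1))).sub ((hE 1).mul (hX1 1))).add
      (((line _ hre z 1).const_mul 2).mul (line _ hpD z 1))).sub ((line _ hud z 1).const_mul 2)
    have hWd := ((((((line _ hpD z Complex.I).mul (line _ hqD z Complex.I)).mul (hX1 Complex.I)).add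
      (((((line _ hqD z Complex.I).pow 2).sub ((line _ hpD z Complex.I).pow 2)).div_const 2).mul
        (hX2 Complex.I))).sub ((hE Complex.I).mul (hX2 Complex.I))).add
      (((line _ hre z Complex.I).const_mul 2).mul (line _ hqD z Complex.I)))
    have e1 : pd V 1 z = _ := (line V hV z 1).unique hVd
    have e2 : pd W Complex.I z = _ := (line W hW z Complex.I).unique hWd
    rw [e1, e2]
    have hl := hpde z hz
    simp only [lap] at hl
    change -(fderiv ℝ p z 1 + fderiv ℝ q z Complex.I) = _ at hl
    have hu1 : fderiv ℝ u z 1 = p z := rfl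
    have huI : fderiv ℝ u z Complex.I = q z := rfl
    simp only [dre, dim, hsymm, hu1, huI, Pi.add_apply, Pi.mul_apply, Pi.sub_apply, Pi.pow_apply,
      Complex.one_re, Complex.one_im, Complex.I_re, Complex.I_im, zero_smul, add_zero]
    have hc : fderiv ℝ q z Complex.I = 2 * Real.exp (u z) - fderiv ℝ p z 1 := by linarith
    rw [hc]
    push_cast
    ring
  have hflux := flux_zero hV hW hdiv
  set E : ℝ → ℝ := fun θ => Real.exp (u (pol (1, θ)) / 2) with hE
  have hcp : Continuous (fun θ : ℝ => pol (1, θ)) :=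
    pol_diff.continuous.comp (by fun_prop)
  have hEc : Continuous E :=
    Real.continuous_exp.comp ((hud.continuous.comp hcp).div_const 2)
  set I : ℝ → ℝ := fun θ => Real.cos θ * V (pol (1, θ)) + Real.sin θ * W (pol (1, θ)) with hI
  have hIc : Continuous I :=
    (Real.continuous_cos.mul (hV.continuous.comp hcp)).add
      (Real.continuous_sin.mul (hW.continuous.comp hcp))
  have hJc : Continuous (fun θ => Real.sin θ ^ 2 * E θ) := (Real.continuous_sin.pow 2).mul hEc
  have hder : ∀ θ : ℝ, HasDerivAt (fun θ => 4 * ((3 + Real.cos θ) * Real.sin θ * E θ)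
      - 2 * (Real.sin θ * u (pol (1, θ))) - 4 * Real.sin θ)
      (I θ - 4 * (Real.sin θ ^ 2 * E θ)) θ := by
    intro θ
    have hU := comp_dt hud 1 θ
    have h := (((((Real.hasDerivAt_cos θ).const_add 3).mul (Real.hasDerivAt_sin θ)).mul
      ((hU.div_const 2).exp)).const_mul 4).sub
      (((Real.hasDerivAt_sin θ).mul hU).const_mul 2) |>.sub ((Real.hasDerivAt_sin θ).const_mul 4)
    refine h.congr_deriv ?_
    have hb := hbc (pol (1, θ)) (by simp [unitCircle, pol_norm])
    have hp1 : pd u 1 (pol (1, θ)) = p (pol (1, θ)) := rfl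
    have hq1 : pd u Complex.I (pol (1, θ)) = q (pol (1, θ)) := rfl
    simp only [nderiv, pol_re, pol_im, hp1, hq1, one_mul] at hb
    simp only [hI, hVdef, hWdef, hE, pol_re, pol_im, hp1, hq1, one_mul, Pi.mul_apply]
    have hcs := Real.sin_sq_add_cos_sq θ
    linear_combination
      -(Real.sin θ * (-Real.sin θ * p (pol (1, θ)) + Real.cos θ * q (pol (1, θ)))
        + 2 * Real.cos θ) * hb
      - (Real.sin θ * (p (pol (1, θ)) * q (pol (1, θ))) / 2
        + Real.cos θ * ((p (pol (1, θ)) ^ 2 - q (pol (1, θ)) ^ 2) / 2) / 2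
        - Real.cos θ * Real.exp (u (pol (1, θ)))) * hcs
  have hint := intervalIntegral.integral_eq_sub_of_hasDerivAt (a := 0) (b := 2 * π)
    (fun θ _ => hder θ) ((hIc.sub (hJc.const_mul 4)).intervalIntegrable _ _)
  rw [intervalIntegral.integral_sub (hIc.intervalIntegrable _ _)
    ((hJc.const_mul 4).intervalIntegrable _ _), hflux] at hint
  simp at hint
  have hpos : 0 < ∫ θ in (0:ℝ)..(2 * π), Real.sin θ ^ 2 * E θ := by
    refine intervalIntegral.integral_pos (by positivity) hJc.continuousOn
      (fun x _ => by positivity) ⟨π / 2, ⟨by positivity, by linarith [Real.pi_pos]⟩, ?_⟩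
    simp only [Real.sin_pi_div_two]
    positivity
  exact absurd hint hpos.ne'

end
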